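/- Let X be a Banach space and V a bounded, closed, convex subset of X. Let Π₁, Π₂ : V → X be maps such that (i) Π₁(x) + Π₂(y) ∈ V for all x, y ∈ V, (ii) Π₁ is a contraction, and (iii) Π₂ is continuous and Π₂(V) is contained in a compact set. Then there exists z ∈ V with z = Π₁(z) + Π₂(z). -/

import Mathlib

open Set Metric MeasureTheory

/-- A contractive perturbation of the identity is a bijection. -/
theorem LipschitzWith.bijective_id_add {E : Type*} [NormedAddCommGroup E] [CompleteSpace E]
    {c : NNReal} (hc : c < 1) {h : E → E} (hh : LipschitzWith c h) :
    Function.Bijective fun x => x + h x := by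
  constructor
  · intro x y hxy
    have h1 : ‖x - y‖ ≤ c * ‖x - y‖ := by
      have h2 : x - y = -(h x - h y) := by
        have h3 : x + h x = y + h y := hxy
        rw [neg_sub, sub_eq_sub_iff_add_eq_add, h3, add_comm]
      calc ‖x - y‖ = ‖h x - h y‖ := by rw [h2, norm_neg]
        _ ≤ c * ‖x - y‖ := hh.norm_sub_le x y
    have hc' : (c : ℝ) < 1 := by exact_mod_cast hc
    have h4 : ‖x - y‖ = 0 := by nlinarith [norm_nonneg (x - y)]
    exact sub_eq_zero.1 (norm_eq_zero.1 h4)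
  · intro y
    have hcon : ContractingWith c fun x => y - h x := by
      refine ⟨hc, LipschitzWith.of_dist_le_mul fun a b => ?_⟩
      rw [dist_sub_left]
      exact hh.dist_le_mul a b
    refine ⟨hcon.fixedPoint, ?_⟩
    have h5 : y - h hcon.fixedPoint = hcon.fixedPoint := hcon.fixedPoint_isFixedPt
    exact (sub_eq_iff_eq_add.1 h5).symm

theorem Function.Bijective.image_eq_of_eqOn_compl {α : Type*} {f : α → α}
    (hf : Function.Bijective f) {s : Set α} (h : ∀ x ∉ s, f x = x) : f '' s = s := by
  ext y
  constructor
  · rintro ⟨x, hx, rfl⟩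
    by_contra hy
    exact hy (by rwa [hf.1 (h _ hy)])
  · intro hy
    obtain ⟨x, rfl⟩ := hf.2 y
    by_cases hx : x ∈ s
    · exact ⟨x, hx, rfl⟩
    · exact absurd (h x hx ▸ hy) hx

/-- A function that is Lipschitz on a closed ball and vanishes on its boundary remains Lipschitz
when it is set to zero outside the ball. -/
theorem LipschitzOnWith.indicator_ball {E F : Type*} [NormedAddCommGroup E] [NormedSpace ℝ E]
    [NormedAddCommGroup F] {K : NNReal} {R : ℝ} {g : E → F}
    (hg : LipschitzOnWith K g (closedBall 0 R)) (h0 : ∀ x, ‖x‖ = R → g x = 0) :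
    LipschitzWith K ((ball 0 R).indicator g) := by
  have key : ∀ x ∈ ball (0 : E) R, ∀ y ∉ ball (0 : E) R, ‖g x‖ ≤ K * ‖x - y‖ := by
    intro x hx y hy
    have hc : ContinuousOn (fun t : ℝ => ‖AffineMap.lineMap x y t‖) (Icc 0 1) := by
      refine Continuous.continuousOn ?_
      exact (AffineMap.lineMap_continuous).norm
    have hx' : ‖x‖ < R := by simpa using hx
    have hy' : R ≤ ‖y‖ := by simpa using hy
    obtain ⟨t, ht, htR⟩ := intermediate_value_Icc zero_le_one hc
      (show R ∈ Icc _ _ by simpa using ⟨hx'.le, hy'⟩)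
    set z : E := AffineMap.lineMap x y t with hz
    have hzR : ‖z‖ = R := htR
    have h1 := hg.norm_sub_le (ball_subset_closedBall hx)
      (show z ∈ closedBall (0 : E) R by simp [hzR])
    rw [h0 z hzR, sub_zero] at h1
    refine h1.trans (mul_le_mul_of_nonneg_left ?_ K.coe_nonneg)
    have h2 : ‖x - z‖ = t * ‖x - y‖ := by
      rw [← dist_eq_norm, hz, dist_left_lineMap, dist_eq_norm, Real.norm_of_nonneg ht.1]
    rw [h2]
    exact mul_le_of_le_one_left (norm_nonneg _) ht.2
  refine LipschitzWith.of_dist_le_mul fun x y => ?_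
  rw [dist_eq_norm, dist_eq_norm]
  by_cases hx : x ∈ ball (0 : E) R <;> by_cases hy : y ∈ ball (0 : E) R
  · rw [indicator_of_mem hx, indicator_of_mem hy]
    exact hg.norm_sub_le (ball_subset_closedBall hx) (ball_subset_closedBall hy)
  · rw [indicator_of_mem hx, indicator_of_notMem hy, sub_zero]
    exact key x hx y hy
  · rw [indicator_of_notMem hx, indicator_of_mem hy, zero_sub, norm_neg, norm_sub_rev]
    exact key y hy x hx
  · rw [indicator_of_notMem hx, indicator_of_notMem hy, sub_zero, norm_zero]
    positivity

open Polynomial in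
theorem LinearMap.exists_polynomial_eval_eq_det {E : Type*} [AddCommGroup E] [Module ℝ E]
    [FiniteDimensional ℝ E] (A : E →ₗ[ℝ] E) :
    ∃ p : ℝ[X], p.natDegree ≤ Module.finrank ℝ E ∧
      ∀ t : ℝ, p.eval t = LinearMap.det (1 + t • A) := by
  let b := Module.finBasis ℝ E
  let M := LinearMap.toMatrix b b A
  refine ⟨Matrix.det ((X : ℝ[X]) • M.map C + (1 : Matrix _ _ ℝ).map C), ?_, fun t => ?_⟩
  · simpa using natDegree_det_X_add_C_le M 1
  · rw [← LinearMap.det_toMatrix b, ← coe_evalRingHom, RingHom.map_det]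
    congr 1
    ext i j
    by_cases h : i = j <;> simp [M, h] <;> ring

open Polynomial in
/-- Evaluation at `1` of polynomials of bounded degree is a linear combination, normalised by its
value on constants, of evaluations at points close to `0`. -/
theorem exists_sum_eval_eq_eval_one (n : ℕ) {τ : ℝ} (hτ : 0 < τ) :
    ∃ v w : Fin (n + 1) → ℝ, (∀ i, v i ∈ Icc 0 τ) ∧ ∑ i, w i = 1 ∧
      ∀ p : ℝ[X], p.natDegree ≤ n → p.eval 1 = ∑ i, w i * p.eval (v i) := by
  let v : Fin (n + 1) → ℝ := fun i => τ * (i / (n + 1))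
  have hv : Function.Injective v := by
    intro i j hij
    have : (n + 1 : ℝ) ≠ 0 := by positivity
    simp only [v] at hij
    field_simp at hij
    exact Fin.ext (by exact_mod_cast hij)
  have hw : ∀ p : ℝ[X], p.natDegree ≤ n →
      p.eval 1 = ∑ i, (Lagrange.basis Finset.univ v i).eval 1 * p.eval (v i) := by
    intro p hp
    have h1 := Lagrange.eq_interpolate (s := Finset.univ) (f := p) hv.injOn (by
      refine degree_le_natDegree.trans_lt ?_
      simp only [Finset.card_univ, Fintype.card_fin]
      exact_mod_cast Nat.lt_succ_of_le hp)
    conv_lhs => rw [h1, Lagrange.interpolate_apply, eval_finsetSum]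
    exact Finset.sum_congr rfl fun i _ => by rw [eval_mul, eval_C, mul_comm]
  refine ⟨v, fun i => (Lagrange.basis Finset.univ v i).eval 1, fun i => ?_, ?_, hw⟩
  · have h1 : (i : ℝ) / (n + 1) ≤ 1 := by
      rw [div_le_one (by positivity)]
      exact_mod_cast i.2.le
    exact ⟨by positivity, mul_le_of_le_one_right hτ.le h1⟩
  · simpa using (hw 1 (by simp)).symm

section Brouwer

variable {E : Type*} [NormedAddCommGroup E] [InnerProductSpace ℝ E] [FiniteDimensional ℝ E]

/-- The derivative of a map of constant nonzero norm is singular. -/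
theorem ContinuousLinearMap.det_eq_zero_of_hasFDerivAt_of_norm_eq
    {f : E → E} {f' : E →L[ℝ] E} {x : E} {R : ℝ}
    (hR : 0 < R) (hf : HasFDerivAt f f' x) (hn : ∀ y, ‖f y‖ = R) : f'.det = 0 := by
  by_contra hdet
  have horth : ∀ v, inner ℝ (f x) (f' v) = 0 := by
    intro v
    have h1 := hf.norm_sq
    have h2 : (fun y => ‖f y‖ ^ 2) = fun _ => R ^ 2 := by
      funext y
      rw [hn]
    rw [h2] at h1
    have h3 := h1.unique (hasFDerivAt_const (R ^ 2) x)
    simpa using congrArg (fun L => L v) h3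
  obtain ⟨v, hv⟩ := (LinearMap.equivOfDetNeZero (f' : E →ₗ[ℝ] E) hdet).surjective (f x)
  have h4 : f' v = f x := hv
  have h5 := horth v
  rw [h4, real_inner_self_eq_norm_sq, hn] at h5
  exact hR.ne' (pow_eq_zero_iff two_ne_zero |>.1 h5)

/-- A small Lipschitz perturbation of the identity, supported in a ball, preserves the volume
of that ball. -/
theorem setIntegral_det_one_add_eq_measureReal_ball [MeasurableSpace E] [BorelSpace E]
    {R : ℝ} {h : E → E} {h' : E → E →L[ℝ] E} {c : NNReal} (hc : c < 1)
    (hlip : LipschitzWith c ((ball 0 R).indicator h))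
    (hder : ∀ x, HasFDerivAt h (h' x) x) (hdet : ∀ x ∈ ball (0 : E) R, 0 ≤ (1 + h' x).det) :
    ∫ x in ball (0 : E) R, (1 + h' x).det = volume.real (ball (0 : E) R) := by
  set g := (ball (0 : E) R).indicator h
  have hbij := hlip.bijective_id_add hc
  have himage := hbij.image_eq_of_eqOn_compl (s := ball (0 : E) R) fun x hx => by
    simp [g, indicator_of_notMem hx]
  have hd : ∀ x ∈ ball (0 : E) R,
      HasFDerivWithinAt (fun x => x + g x) (1 + h' x) (ball 0 R) x := by
    intro x hx
    refine ((hasFDerivAt_id x).add (hder x)).hasFDerivWithinAt.congr (fun y hy => ?_) ?_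
    · simp [g, indicator_of_mem hy]
    · simp [g, indicator_of_mem hx]
  have hcv := integral_image_eq_integral_abs_det_fderiv_smul volume measurableSet_ball hd
    hbij.1.injOn (fun _ => (1 : ℝ))
  rw [himage] at hcv
  simp only [smul_eq_mul, mul_one, setIntegral_const] at hcv
  rw [hcv]
  exact setIntegral_congr_fun measurableSet_ball fun x hx => (abs_of_nonneg (hdet x hx)).symm

/-- There is no `C¹` retraction of a closed ball onto its boundary sphere. -/
theorem not_contDiff_retraction_sphere {R : ℝ} (hR : 0 < R) {f : E → E}
    (hf : ContDiff ℝ 1 f) (hn : ∀ x, ‖f x‖ = R) (hfix : ∀ x, ‖x‖ = R → f x = x) : False := by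
  borelize E
  set g : E → E := fun x => f x - x
  have hg : ContDiff ℝ 1 g := hf.sub contDiff_id
  have hgd : ∀ x, HasFDerivAt g (fderiv ℝ g x) x := fun x =>
    (hg.differentiable one_ne_zero x).hasFDerivAt
  have hg' : Continuous (fderiv ℝ g) := hg.continuous_fderiv one_ne_zero
  obtain ⟨C, hC⟩ := (isCompact_closedBall (0 : E) R).exists_bound_of_continuousOn hg'.continuousOn
  set K : NNReal := C.toNNReal
  have hK : ∀ x ∈ closedBall (0 : E) R, ‖fderiv ℝ g x‖ ≤ K := fun x hx =>
    (hC x hx).trans (Real.le_coe_toNNReal C)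
  have hlip : LipschitzOnWith K g (closedBall 0 R) :=
    (convex_closedBall 0 R).lipschitzOnWith_of_nnnorm_fderiv_le
      (fun x _ => hg.differentiable one_ne_zero x) hK
  have hpos : ∀ᶠ A : E →L[ℝ] E in nhds 0, 0 < (1 + A).det := by
    have : ContinuousAt (fun A : E →L[ℝ] E => (1 + A).det) 0 :=
      (ContinuousLinearMap.continuous_det.comp (continuous_const.add continuous_id)).continuousAt
    refine this.eventually (lt_mem_nhds ?_)
    simp [ContinuousLinearMap.det]
  obtain ⟨δ, hδ, hδpos⟩ := Metric.eventually_nhds_iff.1 hpos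
  obtain ⟨τ, hτ, hτK⟩ : ∃ τ : ℝ, 0 < τ ∧ τ * K < min δ 1 := by
    refine ⟨min δ 1 / (K + 1), by positivity, ?_⟩
    rw [div_mul_eq_mul_div, div_lt_iff₀ (by positivity)]
    exact mul_lt_mul_of_pos_left (lt_add_one _) (by positivity)
  have hvol : ∀ t ∈ Icc 0 τ,
      ∫ x in ball (0 : E) R, (1 + t • fderiv ℝ g x).det = volume.real (ball (0 : E) R) := by
    intro t ht
    have htK : t * K < min δ 1 := (mul_le_mul_of_nonneg_right ht.2 K.coe_nonneg).trans_lt hτK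
    refine setIntegral_det_one_add_eq_measureReal_ball (h := fun x => t • g x)
      (c := t.toNNReal * K) ?_ ?_ (fun x => (hgd x).const_smul t) fun x hx => ?_
    · rw [← NNReal.coe_lt_coe]
      simpa [ht.1] using htK.trans_le (min_le_right _ _)
    · refine LipschitzOnWith.indicator_ball ?_ fun x hx => by simp [g, hfix x hx]
      refine LipschitzOnWith.of_dist_le_mul fun x hx y hy => ?_
      rw [dist_smul₀, NNReal.coe_mul, mul_assoc, Real.coe_toNNReal _ ht.1,
        Real.norm_of_nonneg ht.1]
      exact mul_le_mul_of_nonneg_left (hlip.dist_le_mul x hx y hy) ht.1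
    · refine (hδpos ?_).le
      rw [dist_zero_right, norm_smul, Real.norm_of_nonneg ht.1]
      exact (mul_le_mul_of_nonneg_left (hK x (ball_subset_closedBall hx)) ht.1).trans_lt
        (htK.trans_le (min_le_left _ _))
  obtain ⟨v, w, hv, hw, hvw⟩ := exists_sum_eval_eq_eval_one (Module.finrank ℝ E) hτ
  have hdet : ∀ x, (1 + fderiv ℝ g x).det = ∑ i, w i * (1 + v i • fderiv ℝ g x).det := by
    intro x
    obtain ⟨p, hp, hpe⟩ := LinearMap.exists_polynomial_eval_eq_det (fderiv ℝ g x : E →ₗ[ℝ] E)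
    have h1 := hvw p hp
    simp only [hpe, one_smul] at h1
    exact h1
  have hzero : ∀ x, (1 + fderiv ℝ g x).det = 0 := by
    intro x
    have hfx : HasFDerivAt f (1 + fderiv ℝ g x) x :=
      ((hasFDerivAt_id x).add (hgd x)).congr_of_eventuallyEq
        (Filter.Eventually.of_forall fun y => by simp [g])
    exact ContinuousLinearMap.det_eq_zero_of_hasFDerivAt_of_norm_eq hR hfx hn
  have hintegrable : ∀ i, IntegrableOn (fun x => w i * (1 + v i • fderiv ℝ g x).det)
      (ball (0 : E) R) := by
    intro i
    have hcont : Continuous fun x => w i * (1 + v i • fderiv ℝ g x).det :=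
      continuous_const.mul (ContinuousLinearMap.continuous_det.comp
        (continuous_const.add (hg'.const_smul (v i))))
    exact (hcont.continuousOn.integrableOn_compact (isCompact_closedBall 0 R)).mono_set
      ball_subset_closedBall
  have htotal : (0 : ℝ) = volume.real (ball (0 : E) R) := by
    calc (0 : ℝ) = ∫ x in ball (0 : E) R, (1 + fderiv ℝ g x).det := by simp [hzero]
      _ = ∑ i, w i * ∫ x in ball (0 : E) R, (1 + v i • fderiv ℝ g x).det := by
        simp_rw [hdet]
        rw [integral_finsetSum _ fun i _ => hintegrable i]
        simp_rw [integral_const_mul]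
      _ = volume.real (ball (0 : E) R) := by
        simp_rw [hvol _ (hv _)]
        rw [← Finset.sum_mul, hw, one_mul]
  have hball : 0 < volume.real (ball (0 : E) R) :=
    ENNReal.toReal_pos (measure_ball_pos _ _ hR).ne' measure_ball_lt_top.ne
  exact hball.ne htotal

/-- **Brouwer's fixed point theorem** for continuous maps of the whole space into the unit ball. -/
theorem exists_fixedPoint_of_norm_le_one {F : E → E} (hF : Continuous F)
    (hF1 : ∀ x, ‖F x‖ ≤ 1) : ∃ x, F x = x := by
  by_contra! hne
  obtain ⟨δ, hδ, hδF⟩ : ∃ δ : ℝ, 0 < δ ∧ ∀ x ∈ closedBall (0 : E) 2, δ ≤ ‖F x - x‖ := by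
    obtain ⟨x₀, -, hx₀⟩ := (isCompact_closedBall (0 : E) 2).exists_isMinOn
      (nonempty_closedBall.2 zero_le_two) (hF.sub continuous_id).norm.continuousOn
    exact ⟨‖F x₀ - x₀‖, norm_pos_iff.2 (sub_ne_zero.2 (hne x₀)), fun x hx => hx₀ hx⟩
  obtain ⟨G, hG, hGF, -⟩ := hF.exists_contDiff_approx 1 (ε := fun _ => min δ 1)
    continuous_const fun _ => by positivity
  have hGF' : ∀ x, ‖F x - G x‖ < min δ 1 := fun x => by
    rw [norm_sub_rev, ← dist_eq_norm]
    exact hGF x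
  have hG2 : ∀ x, ‖G x‖ < 2 := fun x => by
    have h1 := norm_le_norm_add_norm_sub (F x) (G x)
    have h2 := (hGF' x).trans_le (min_le_right _ _)
    linarith [hF1 x]
  have hGne : ∀ x ∈ closedBall (0 : E) 2, G x ≠ x := fun x hx hGx => by
    have h1 := (hGF' x).trans_le (min_le_left _ _)
    rw [hGx] at h1
    exact (hδF x hx).not_gt h1
  let φ : ContDiffBump (0 : E) := ⟨2, 3, by norm_num, by norm_num⟩
  set H : E → E := fun x => x - φ x • G x
  have hH : ContDiff ℝ 1 H := contDiff_id.sub (φ.contDiff.smul hG)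
  have hH0 : ∀ x, H x ≠ 0 := by
    intro x hx
    have h1 : x = φ x • G x := sub_eq_zero.1 hx
    have h2 : x ∈ closedBall (0 : E) 2 := by
      rw [mem_closedBall_zero_iff, h1, norm_smul, Real.norm_of_nonneg φ.nonneg]
      exact (mul_le_of_le_one_left (norm_nonneg _) φ.le_one).trans (hG2 x).le
    rw [φ.one_of_mem_closedBall h2, one_smul] at h1
    exact hGne x h2 h1.symm
  refine not_contDiff_retraction_sphere (R := 3) (f := fun x => (3 / ‖H x‖) • H x) (by norm_num)
    ((contDiff_const.div (hH.norm ℝ hH0) fun x => norm_ne_zero_iff.2 (hH0 x)).smul hH) ?_ ?_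
  · intro x
    have := norm_ne_zero_iff.2 (hH0 x)
    rw [norm_smul, norm_div, norm_norm]
    field_simp
    norm_num
  · intro x hx
    have h1 : H x = x := by
      have : φ x = 0 := φ.zero_of_le_dist (by simpa using hx.ge)
      simp [H, this]
    simp only [h1, hx]
    norm_num

end Brouwer

section Schauder

variable {ι : Type*} [Fintype ι]

/-- The standard simplex is a retract of its ambient space. -/
theorem exists_continuous_retraction_stdSimplex [Nonempty ι] :
    ∃ r : (ι → ℝ) → ι → ℝ, Continuous r ∧ (∀ x, r x ∈ stdSimplex ℝ ι) ∧
      ∀ x ∈ stdSimplex ℝ ι, r x = x := by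
  let s : (ι → ℝ) → ℝ := fun x => ∑ i, max (x i) 0
  have hs : Continuous s := by fun_prop
  have hm : ∀ x, 0 < max (s x) 1 := fun x => zero_lt_one.trans_le (le_max_right _ _)
  refine ⟨fun x i => (max (x i) 0 + max (1 - s x) 0 / Fintype.card ι) / max (s x) 1,
    continuous_pi fun i => ?_, fun x => ⟨fun i => ?_, ?_⟩, fun x hx => ?_⟩
  · exact Continuous.div (by fun_prop) (by fun_prop) fun x => (hm x).ne'
  · have := hm x
    positivity
  · rw [← Finset.sum_div, div_eq_one_iff_eq (hm x).ne', Finset.sum_add_distrib, Finset.sum_const,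
      Finset.card_univ, nsmul_eq_mul, mul_div_cancel₀ _ (by simp)]
    change s x + _ = _
    rcases le_total (s x) 1 with h | h
    · rw [max_eq_left (by linarith), max_eq_right h]
      ring
    · rw [max_eq_right (by linarith), max_eq_left h, add_zero]
  · have h1 : ∀ i, max (x i) 0 = x i := fun i => max_eq_left (hx.1 i)
    have h2 : s x = 1 := by simp only [s, h1, hx.2]
    funext i
    simp [h1, h2]

theorem norm_toLp_le_one_of_mem_stdSimplex {x : ι → ℝ} (hx : x ∈ stdSimplex ℝ ι) :
    ‖WithLp.toLp 2 x‖ ≤ 1 := by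
  rw [EuclideanSpace.norm_eq, Real.sqrt_le_iff, one_pow, ← hx.2]
  refine ⟨hx.2 ▸ zero_le_one, ?_⟩
  refine Finset.sum_le_sum fun i _ => ?_
  have h1 : x i ≤ 1 := hx.2 ▸ Finset.single_le_sum (fun j _ => hx.1 j) (Finset.mem_univ i)
  rw [Real.norm_eq_abs, sq_abs]
  nlinarith [hx.1 i]

/-- **Brouwer's fixed point theorem** for the standard simplex. -/
theorem exists_fixedPoint_stdSimplex [Nonempty ι] {F : (ι → ℝ) → ι → ℝ}
    (hF : ContinuousOn F (stdSimplex ℝ ι)) (hmaps : MapsTo F (stdSimplex ℝ ι) (stdSimplex ℝ ι)) :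
    ∃ x ∈ stdSimplex ℝ ι, F x = x := by
  obtain ⟨r, hr, hrmem, hrid⟩ := exists_continuous_retraction_stdSimplex (ι := ι)
  have hFr : Continuous fun x => F (r x) := hF.comp_continuous hr hrmem
  obtain ⟨x, hx⟩ := exists_fixedPoint_of_norm_le_one
    (F := fun x : EuclideanSpace ℝ ι => WithLp.toLp 2 (F (r x.ofLp)))
    ((PiLp.continuous_toLp 2 _).comp (hFr.comp (PiLp.continuous_ofLp 2 _)))
    fun x => norm_toLp_le_one_of_mem_stdSimplex (hmaps (hrmem _))
  have h1 : F (r x.ofLp) = x.ofLp := congrArg WithLp.ofLp hx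
  have h2 : x.ofLp ∈ stdSimplex ℝ ι := h1 ▸ hmaps (hrmem _)
  exact ⟨x.ofLp, h2, by rwa [hrid _ h2] at h1⟩

variable {X : Type*} [NormedAddCommGroup X] [NormedSpace ℝ X]

/-- A continuous self-map of a convex set with totally bounded image has approximate fixed
points. -/
theorem Convex.exists_norm_sub_le_of_totallyBounded {V : Set X} (hV : Convex ℝ V)
    (hne : V.Nonempty) {S : X → X} (hS : ContinuousOn S V) (hmaps : MapsTo S V V)
    (htb : TotallyBounded (S '' V)) {ε : ℝ} (hε : 0 < ε) : ∃ y ∈ V, ‖S y - y‖ ≤ ε := by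
  obtain ⟨t, htS, htfin, htcover⟩ := finite_approx_of_totallyBounded htb ε hε
  have htV : ∀ i ∈ t, i ∈ V := fun i hi => hmaps.image_subset (htS hi)
  have : Fintype t := htfin.fintype
  let w : t → X → ℝ := fun i y => max (ε - ‖S y - i‖) 0
  let σ : X → ℝ := fun y => ∑ i, w i y
  have hw0 : ∀ i y, 0 ≤ w i y := fun i y => le_max_right _ _
  have hσ : ∀ y ∈ V, 0 < σ y := by
    intro y hy
    obtain ⟨i, hi, hyi⟩ := mem_iUnion₂.1 (htcover (mem_image_of_mem S hy))
    refine Finset.sum_pos' (fun i _ => hw0 i y) ⟨⟨i, hi⟩, Finset.mem_univ _, lt_max_of_lt_left ?_⟩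
    rw [← dist_eq_norm]
    exact sub_pos.2 hyi
  have : Nonempty t := by
    obtain ⟨y, hy⟩ := hne
    by_contra hempty
    rw [not_nonempty_iff] at hempty
    exact (hσ y hy).ne' (by simp [σ])
  have hwc : ∀ i, ContinuousOn (w i) V := fun i => by fun_prop
  have hσc : ContinuousOn σ V := by fun_prop
  let c : (t → ℝ) → X := fun a => ∑ i, a i • (i : X)
  have hc : Continuous c := by fun_prop
  have hcV : MapsTo c (stdSimplex ℝ t) V := fun a ha =>
    hV.sum_mem (fun i _ => ha.1 i) ha.2 fun i _ => htV i i.2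
  obtain ⟨a, ha, hfix⟩ := exists_fixedPoint_stdSimplex (ι := t)
    (F := fun a i => w i (c a) / σ (c a))
    (continuousOn_pi.2 fun i => ((hwc i).comp hc.continuousOn hcV).div
      (hσc.comp hc.continuousOn hcV) fun a ha => (hσ _ (hcV ha)).ne')
    (fun a ha => ⟨fun i => div_nonneg (hw0 _ _) (hσ _ (hcV ha)).le, by
      rw [← Finset.sum_div]
      exact div_self (hσ _ (hcV ha)).ne'⟩)
  refine ⟨c a, hcV ha, ?_⟩
  have hdiff : S (c a) - c a = ∑ i, a i • (S (c a) - i) := by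
    simp_rw [smul_sub]
    rw [Finset.sum_sub_distrib, ← Finset.sum_smul, ha.2, one_smul]
  rw [hdiff]
  calc ‖∑ i, a i • (S (c a) - i)‖ ≤ ∑ i, a i * ε := by
        refine norm_sum_le_of_le _ fun i _ => ?_
        rw [norm_smul, Real.norm_of_nonneg (ha.1 i)]
        rcases le_total ‖S (c a) - i‖ ε with h | h
        · exact mul_le_mul_of_nonneg_left h (ha.1 i)
        · have h1 : a i = 0 := by
            rw [← congrFun hfix i]
            simp [w, h]
          simp [h1]
    _ = ε := by rw [← Finset.sum_mul, ha.2, one_mul]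

/-- **Schauder's fixed point theorem**. -/
theorem Convex.exists_fixedPoint_of_totallyBounded [CompleteSpace X] {V : Set X}
    (hV : Convex ℝ V) (hclosed : IsClosed V) (hne : V.Nonempty) {S : X → X}
    (hS : ContinuousOn S V) (hmaps : MapsTo S V V) (htb : TotallyBounded (S '' V)) :
    ∃ z ∈ V, S z = z := by
  choose y hyV hy using fun n : ℕ => hV.exists_norm_sub_le_of_totallyBounded hne hS hmaps htb
    (Nat.one_div_pos_of_nat (α := ℝ) (n := n))
  have hK : IsCompact (closure (S '' V)) :=
    htb.closure.isCompact_of_isClosed isClosed_closure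
  obtain ⟨z, hz, ψ, hψ, hlim⟩ := hK.tendsto_subseq
    fun n => subset_closure (mem_image_of_mem S (hyV n))
  have hzV : z ∈ V := closure_minimal hmaps.image_subset hclosed hz
  have hdiff : Filter.Tendsto (fun n => S (y (ψ n)) - y (ψ n)) Filter.atTop (nhds 0) :=
    (squeeze_zero_norm hy tendsto_one_div_add_atTop_nhds_zero_nat).comp hψ.tendsto_atTop
  have hylim : Filter.Tendsto (fun n => y (ψ n)) Filter.atTop (nhds z) := by
    simpa using hlim.sub hdiff
  have hSlim : Filter.Tendsto (fun n => S (y (ψ n))) Filter.atTop (nhds (S z)) :=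
    (hS z hzV).tendsto.comp
      (tendsto_nhdsWithin_iff.2 ⟨hylim, Filter.Eventually.of_forall fun n => hyV _⟩)
  exact ⟨z, hzV, tendsto_nhds_unique hSlim hlim⟩

end Schauder

/-- A map that contracts distances on a complete set, and sends it to itself, has a fixed point
there. -/
theorem IsComplete.exists_fixedPoint_of_norm_sub_le {X : Type*} [NormedAddCommGroup X]
    {V : Set X} (hV : IsComplete V) (hne : V.Nonempty) {T : X → X} (hmaps : MapsTo T V V) {k : ℝ}
    (hk0 : 0 ≤ k) (hk1 : k < 1) (hT : ∀ x ∈ V, ∀ y ∈ V, ‖T x - T y‖ ≤ k * ‖x - y‖) :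
    ∃ x ∈ V, T x = x := by
  obtain ⟨x₀, hx₀⟩ := hne
  have hcon : ContractingWith ⟨k, hk0⟩ (hmaps.restrict T V V) := by
    refine ⟨by exact_mod_cast hk1, LipschitzWith.of_dist_le_mul fun x y => ?_⟩
    rw [Subtype.dist_eq, Subtype.dist_eq, dist_eq_norm, dist_eq_norm]
    exact hT x x.2 y y.2
  obtain ⟨x, hxV, hx, -⟩ := hcon.exists_fixedPoint' hV hmaps hx₀ (edist_ne_top _ _)
  exact ⟨x, hxV, hx⟩

theorem LipschitzOnWith.totallyBounded_image {α β : Type*} [PseudoMetricSpace α]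
    [PseudoMetricSpace β] {K : NNReal} {f : α → β} {s : Set α} (hf : LipschitzOnWith K f s)
    (hs : TotallyBounded s) : TotallyBounded (f '' s) := by
  refine Metric.totallyBounded_iff.2 fun ε hε => ?_
  obtain ⟨t, hts, htfin, hcover⟩ := finite_approx_of_totallyBounded hs (ε / (K + 1))
    (by positivity)
  refine ⟨f '' t, htfin.image f, ?_⟩
  rintro _ ⟨x, hx, rfl⟩
  obtain ⟨y, hy, hxy⟩ := mem_iUnion₂.1 (hcover hx)
  refine mem_iUnion₂.2 ⟨f y, mem_image_of_mem f hy, ?_⟩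
  rw [mem_ball, lt_div_iff₀ (by positivity)] at hxy
  have h1 := hf.dist_le_mul x hx y (hts hy)
  rw [mem_ball]
  linarith [dist_nonneg (x := x) (y := y)]

/-- Krasnoselskii's fixed point theorem: if `V` is a nonempty bounded closed convex
subset of a Banach space `X`, `P₁ x + P₂ y ∈ V` for all `x, y ∈ V`, `P₁` is a
contraction on `V`, and `P₂` is continuous on `V` with relatively compact image, then
there is `z ∈ V` with `z = P₁ z + P₂ z`. -/
theorem krasnoselskii_fixed_point
    {X : Type*} [NormedAddCommGroup X] [NormedSpace ℝ X] [CompleteSpace X]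
    (V : Set X) (hVne : V.Nonempty) (hVb : Bornology.IsBounded V)
    (hVc : IsClosed V) (hVconv : Convex ℝ V)
    (P₁ P₂ : X → X)
    (hsum : ∀ x ∈ V, ∀ y ∈ V, P₁ x + P₂ y ∈ V)
    (hcontr : ∃ k : ℝ, 0 ≤ k ∧ k < 1 ∧
      ∀ x ∈ V, ∀ y ∈ V, ‖P₁ x - P₁ y‖ ≤ k * ‖x - y‖)
    (hcont : ContinuousOn P₂ V)
    (hcompact : ∃ K : Set X, IsCompact K ∧ P₂ '' V ⊆ K) :
    ∃ z ∈ V, z = P₁ z + P₂ z := by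
  obtain ⟨k, hk0, hk1, hk⟩ := hcontr
  obtain ⟨K, hK, hP₂K⟩ := hcompact
  have hex : ∀ u ∈ P₂ '' V, ∃ x ∈ V, P₁ x + u = x := by
    rintro _ ⟨y, hy, rfl⟩
    refine hVc.isComplete.exists_fixedPoint_of_norm_sub_le (T := fun x => P₁ x + P₂ y) hVne
      (fun x hx => hsum x hx y hy) hk0 hk1 fun x hx x' hx' => ?_
    rw [add_sub_add_right_eq_sub]
    exact hk x hx x' hx'
  choose! T hTV hT using hex
  have hlip : LipschitzOnWith (1 - k)⁻¹.toNNReal T (P₂ '' V) := by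
    refine LipschitzOnWith.of_dist_le_mul fun u hu v hv => ?_
    rw [dist_eq_norm, dist_eq_norm, Real.coe_toNNReal _ (inv_nonneg.2 (sub_pos.2 hk1).le),
      ← div_eq_inv_mul, le_div_iff₀ (sub_pos.2 hk1)]
    have h1 : T u - T v = (P₁ (T u) - P₁ (T v)) + (u - v) := by
      conv_lhs => rw [← hT u hu, ← hT v hv]
      abel
    have h2 : ‖T u - T v‖ ≤ k * ‖T u - T v‖ + ‖u - v‖ := by
      conv_lhs => rw [h1]
      exact (norm_add_le _ _).trans
        (add_le_add_left (hk _ (hTV u hu) _ (hTV v hv)) _)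
    linarith
  have htb : TotallyBounded ((T ∘ P₂) '' V) := by
    rw [image_comp]
    exact hlip.totallyBounded_image (hK.totallyBounded.subset hP₂K)
  obtain ⟨z, hzV, hz⟩ := hVconv.exists_fixedPoint_of_totallyBounded hVc hVne
    (hlip.continuousOn.comp hcont (mapsTo_image P₂ V))
    (fun y hy => hTV _ (mem_image_of_mem P₂ hy)) htb
  refine ⟨z, hzV, ?_⟩
  have h3 := hT (P₂ z) (mem_image_of_mem P₂ hzV)
  rw [show T (P₂ z) = z from hz] at h3
  exact h3.symm
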